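/- arXiv:cs/0701034 — 10 statements merged into one kernel-verified Lean document; each statement's English description precedes it below -/
import Mathlib

section
/- Let ρ > 0 with ρ ≠ 1 and let α̂ ∈ (0,1]. Then the double sums (1/L²)·Σ_{l=1}^{⌊α̂L⌋−1} ρ^{-(l-1)/(L-1)} · Σ_{m=l+1}^{⌊α̂L⌋} ρ^{-(m-1)/(L-1)} converge, as the integer L → ∞, to ρ^{-2α̂}·(ρ^α̂ − 1)² / (2·(ln ρ)²). -/
open Filter Real

theorem two_mul_sum_Icc_mul_sum_Icc_succ {R : Type*} [CommRing R] (f : ℕ → R) (N : ℕ) :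
    2 * ∑ l ∈ Finset.Icc 1 (N - 1), f l * ∑ m ∈ Finset.Icc (l + 1) N, f m =
      (∑ l ∈ Finset.Icc 1 N, f l) ^ 2 - ∑ l ∈ Finset.Icc 1 N, f l ^ 2 := by
  induction N with
  | zero => simp
  | succ n ih =>
    have hinner : ∀ l ∈ Finset.Icc 1 n, f l * ∑ m ∈ Finset.Icc (l + 1) (n + 1), f m =
        f l * ∑ m ∈ Finset.Icc (l + 1) n, f m + f l * f (n + 1) := fun l hl ↦ by
      rw [Finset.sum_Icc_succ_top (by have := (Finset.mem_Icc.mp hl).2; omega), mul_add]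
    have houter : ∑ l ∈ Finset.Icc 1 n, f l * ∑ m ∈ Finset.Icc (l + 1) n, f m =
        ∑ l ∈ Finset.Icc 1 (n - 1), f l * ∑ m ∈ Finset.Icc (l + 1) n, f m := by
      cases n with
      | zero => simp
      | succ k => simp [Finset.sum_Icc_succ_top]
    rw [Nat.add_sub_cancel, Finset.sum_congr rfl hinner, Finset.sum_add_distrib,
      ← Finset.sum_mul, houter, Finset.sum_Icc_succ_top (by omega),
      Finset.sum_Icc_succ_top (by omega)]
    linear_combination ih

theorem tendsto_natCast_sub_one_atTop :
    Tendsto (fun L : ℕ ↦ (L : ℝ) - 1) atTop atTop :=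
  tendsto_atTop_add_const_right _ (-1) tendsto_natCast_atTop_atTop

theorem tendsto_natCast_div_natCast_sub_one :
    Tendsto (fun L : ℕ ↦ (L : ℝ) / ((L : ℝ) - 1)) atTop (nhds 1) := by
  have h := (tendsto_inv_atTop_zero.comp tendsto_natCast_sub_one_atTop).const_add 1
  rw [add_zero] at h
  refine h.congr' ?_
  filter_upwards [tendsto_natCast_sub_one_atTop.eventually_gt_atTop 0] with L hL
  simp only [Function.comp_apply]
  field_simp
  ring

theorem tendsto_natCast_mul_exp_sub_one {c : ℝ} (hc : c ≠ 0) :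
    Tendsto (fun L : ℕ ↦ (L : ℝ) * (exp (-c / ((L : ℝ) - 1)) - 1)) atTop (nhds (-c)) := by
  have hx : Tendsto (fun L : ℕ ↦ -c / ((L : ℝ) - 1)) atTop (nhdsWithin 0 {0}ᶜ) := by
    refine tendsto_nhdsWithin_iff.mpr
      ⟨tendsto_natCast_sub_one_atTop.const_div_atTop _, ?_⟩
    filter_upwards [tendsto_natCast_sub_one_atTop.eventually_gt_atTop 0] with L hL
    exact div_ne_zero (neg_ne_zero.mpr hc) hL.ne'
  have hslope := (hasDerivAt_iff_tendsto_slope.mp (hasDerivAt_exp 0)).comp hx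
  have h := (tendsto_natCast_div_natCast_sub_one.mul_const (-c)).mul hslope
  rw [exp_zero, one_mul, mul_one] at h
  refine h.congr' ?_
  filter_upwards [tendsto_natCast_sub_one_atTop.eventually_gt_atTop 0] with L hL
  simp only [Function.comp_apply, slope_def_field, exp_zero, sub_zero]
  field_simp

theorem tendsto_sum_exp_div_natCast {c : ℝ} (hc : c ≠ 0) {α : ℝ} (hα : 0 ≤ α) :
    Tendsto (fun L : ℕ ↦
        (∑ l ∈ Finset.Icc 1 ⌊α * (L : ℝ)⌋₊, exp (-c * (((l : ℝ) - 1) / ((L : ℝ) - 1)))) / L)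
      atTop (nhds ((exp (-c * α) - 1) / -c)) := by
  have hfloor : Tendsto (fun L : ℕ ↦ (⌊α * (L : ℝ)⌋₊ : ℝ) / ((L : ℝ) - 1)) atTop (nhds α) := by
    have h := ((tendsto_nat_floor_mul_div_atTop hα).comp tendsto_natCast_atTop_atTop).mul
      tendsto_natCast_div_natCast_sub_one
    rw [mul_one] at h
    refine h.congr' ?_
    filter_upwards [eventually_gt_atTop 0] with L hL
    have : (L : ℝ) ≠ 0 := by positivity
    simp only [Function.comp_apply]
    field_simp
  have hnum := ((continuous_exp.tendsto _).comp (hfloor.const_mul (-c))).sub_const 1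
  refine (hnum.div (tendsto_natCast_mul_exp_sub_one hc) (neg_ne_zero.mpr hc)).congr' ?_
  filter_upwards [tendsto_natCast_sub_one_atTop.eventually_gt_atTop 0] with L hL
  have hr : exp (-c / ((L : ℝ) - 1)) ≠ 1 := by
    rw [Ne, exp_eq_one_iff]
    exact div_ne_zero (neg_ne_zero.mpr hc) hL.ne'
  have hsum (N : ℕ) : ∑ l ∈ Finset.Icc 1 N, exp (-c * (((l : ℝ) - 1) / ((L : ℝ) - 1))) =
      ∑ i ∈ Finset.range N, exp (-c / ((L : ℝ) - 1)) ^ i := by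
    rw [Finset.range_eq_Ico, ← Finset.Ico_add_one_right_eq_Icc, ← zero_add 1,
      ← Finset.sum_Ico_add']
    refine Finset.sum_congr rfl fun i _ ↦ ?_
    rw [← exp_nat_mul]
    push_cast
    ring_nf
  rw [hsum, geom_sum_eq hr, ← exp_nat_mul]
  simp only [Function.comp_apply, Pi.div_apply]
  rw [div_div, mul_comm (L : ℝ)]
  ring_nf

/-- Double-sum limit Φ[D_j C_{W_k} C_{W_k}^H D_j]/(σ_k²σ_j²) (eq. (30)):
(1/L²)·Σ_{l=1}^{⌊α̂L⌋−1} ρ^{-(l-1)/(L-1)} Σ_{m=l+1}^{⌊α̂L⌋} ρ^{-(m-1)/(L-1)}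
→ ρ^{-2α̂}(ρ^α̂−1)²/(2 (ln ρ)²). -/
theorem stmt_1 (ρ : ℝ) (hρ : 0 < ρ) (hρ1 : ρ ≠ 1) (α : ℝ) (hα : α ∈ Set.Ioc (0:ℝ) 1) :
    Tendsto (fun L : ℕ =>
        (1 / (L : ℝ) ^ 2) *
          ∑ l ∈ Finset.Icc 1 (⌊α * (L : ℝ)⌋₊ - 1),
            ρ ^ (-(((l : ℝ) - 1) / ((L : ℝ) - 1))) *
              ∑ m ∈ Finset.Icc (l + 1) ⌊α * (L : ℝ)⌋₊,
                ρ ^ (-(((m : ℝ) - 1) / ((L : ℝ) - 1))))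
      atTop
      (nhds (ρ ^ (-(2 * α)) * (ρ ^ α - 1) ^ 2 / (2 * Real.log ρ ^ 2))) := by
  have hlog : log ρ ≠ 0 := log_ne_zero_of_pos_of_ne_one hρ hρ1
  have hlim := ((((tendsto_sum_exp_div_natCast hlog hα.1.le).pow 2).sub
    ((tendsto_sum_exp_div_natCast (mul_ne_zero two_ne_zero hlog) hα.1.le).mul
      (tendsto_inv_atTop_zero.comp tendsto_natCast_atTop_atTop))).div_const 2)
  have hvalue : ρ ^ (-(2 * α)) * (ρ ^ α - 1) ^ 2 / (2 * log ρ ^ 2) =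
      (((exp (-log ρ * α) - 1) / -log ρ) ^ 2 -
        (exp (-(2 * log ρ) * α) - 1) / -(2 * log ρ) * 0) / 2 := by
    have hsq : ρ ^ (-(2 * α)) = exp (-log ρ * α) ^ 2 := by
      rw [rpow_def_of_pos hρ, ← exp_nat_mul]
      push_cast
      ring_nf
    have hmul : exp (-log ρ * α) * ρ ^ α = 1 := by
      rw [rpow_def_of_pos hρ, ← exp_add]
      simp
    rw [hsq, ← mul_pow, mul_sub, hmul]
    field_simp
    ring
  rw [hvalue]
  refine hlim.congr fun L ↦ ?_
  have hdouble := two_mul_sum_Icc_mul_sum_Icc_succ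
    (fun l : ℕ ↦ ρ ^ (-(((l : ℝ) - 1) / ((L : ℝ) - 1)))) ⌊α * (L : ℝ)⌋₊
  have hexp (l : ℕ) : ρ ^ (-(((l : ℝ) - 1) / ((L : ℝ) - 1))) =
      exp (-log ρ * (((l : ℝ) - 1) / ((L : ℝ) - 1))) := by
    rw [rpow_def_of_pos hρ, mul_neg, neg_mul]
  have hexp_sq (l : ℕ) : exp (-log ρ * (((l : ℝ) - 1) / ((L : ℝ) - 1))) ^ 2 =
      exp (-(2 * log ρ) * (((l : ℝ) - 1) / ((L : ℝ) - 1))) := by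
    rw [← exp_nat_mul]
    push_cast
    ring_nf
  simp only [hexp, hexp_sq] at hdouble ⊢
  simp only [Function.comp_apply]
  linear_combination (-1 / (2 * (L : ℝ) ^ 2)) * hdouble
end

section
/- Let ρ > 0 with ρ ≠ 1 and let α̂ ∈ (0,1]. Then the double sums (1/L²)·Σ_{l=1}^{⌊α̂L⌋} ρ^{-(l-1)/(L-1)} · Σ_{m=l+1}^{L} ρ^{-(m-1)/(L-1)} converge, as the integer L → ∞, to ρ^{-1-2α̂}·(ρ^α̂ − 1)·(ρ − 2ρ^α̂ + ρ^{α̂+1}) / (2·(ln ρ)²). -/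
open Filter Real

lemma sum_Icc_succ_pow_pred_mul (q : ℝ) {l L : ℕ} (h : l ≤ L) :
    (∑ m ∈ Finset.Icc (l + 1) L, q ^ (m - 1)) * (1 - q) = q ^ l - q ^ L := by
  induction L, h using Nat.le_induction with
  | base => simp
  | succ L h ih =>
    rw [Finset.sum_Icc_succ_top (by omega), add_mul, ih, Nat.add_sub_cancel]
    ring

lemma sum_pow_mul_sum_pow_mul (q : ℝ) {N L : ℕ} (h : N ≤ L) :
    (∑ l ∈ Finset.Icc 1 N, q ^ (l - 1) * ∑ m ∈ Finset.Icc (l + 1) L, q ^ (m - 1)) *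
      ((1 - q) ^ 2 * (1 + q)) = q * (1 - (q ^ N) ^ 2) - q ^ L * (1 - q ^ N) * (1 + q) := by
  induction N with
  | zero => simp
  | succ N ih =>
    rw [Finset.sum_Icc_succ_top (by omega), add_mul, ih (by omega), Nat.add_sub_cancel]
    linear_combination (q ^ N * (1 - q) * (1 + q)) * sum_Icc_succ_pow_pred_mul q h

lemma tendsto_natCast_div_sub_one :
    Tendsto (fun L : ℕ => (L : ℝ) / ((L : ℝ) - 1)) atTop (nhds 1) := by
  simpa [sub_eq_add_neg] using tendsto_natCast_div_add_atTop (-1 : ℝ)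

lemma tendsto_inv_natCast_sub_one :
    Tendsto (fun L : ℕ => ((L : ℝ) - 1)⁻¹) atTop (nhds 0) :=
  (tendsto_atTop_add_const_right _ (-1 : ℝ) tendsto_natCast_atTop_atTop).inv_tendsto_atTop

lemma tendsto_natCast_mul_one_sub_rpow {ρ : ℝ} (hρ : 0 < ρ) :
    Tendsto (fun L : ℕ => (L : ℝ) * (1 - ρ ^ (-((L : ℝ) - 1)⁻¹))) atTop
      (nhds (Real.log ρ)) := by
  have hd : HasDerivAt (fun x : ℝ => ρ ^ (-x)) (-Real.log ρ) 0 := by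
    simpa using (hasDerivAt_neg (0 : ℝ)).const_rpow hρ
  have ht : Tendsto (fun L : ℕ => ((L : ℝ) - 1)⁻¹) atTop (nhdsWithin 0 {0}ᶜ) := by
    refine tendsto_nhdsWithin_iff.2 ⟨tendsto_inv_natCast_sub_one, ?_⟩
    filter_upwards [eventually_ge_atTop 2] with L hL
    have : (2 : ℝ) ≤ L := by exact_mod_cast hL
    exact inv_ne_zero (by linarith)
  have h := (tendsto_natCast_div_sub_one.mul (hd.tendsto_slope_zero.comp ht)).neg
  rw [one_mul, neg_neg] at h
  refine h.congr' ?_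
  filter_upwards [eventually_ge_atTop 2] with L hL
  have : (2 : ℝ) ≤ L := by exact_mod_cast hL
  have h1 : (L : ℝ) - 1 ≠ 0 := by linarith
  simp only [Function.comp, zero_add, neg_zero, rpow_zero, inv_inv, smul_eq_mul]
  field_simp
  ring

lemma tendsto_rpow_neg_inv_pow {ρ : ℝ} (hρ : 0 < ρ) {N : ℕ → ℕ} {a : ℝ}
    (hN : Tendsto (fun L : ℕ => (N L : ℝ) / L) atTop (nhds a)) :
    Tendsto (fun L : ℕ => (ρ ^ (-((L : ℝ) - 1)⁻¹)) ^ N L) atTop (nhds (ρ ^ (-a))) := by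
  have h := ((continuous_const_rpow hρ.ne').tendsto _).comp
    (hN.mul tendsto_natCast_div_sub_one).neg
  rw [mul_one] at h
  refine h.congr' ?_
  filter_upwards [eventually_ge_atTop 1] with L hL
  have : (L : ℝ) ≠ 0 := by positivity
  rw [Function.comp_apply, ← rpow_mul_natCast hρ.le]
  congr 1
  field_simp

lemma limit_closed_form {ρ : ℝ} (hρ : 0 < ρ) (α : ℝ) :
    ρ ^ (-1 - 2 * α) * (ρ ^ α - 1) * (ρ - 2 * ρ ^ α + ρ ^ (α + 1)) / (2 * Real.log ρ ^ 2) =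
      (1 * (1 - (ρ ^ (-α)) ^ 2) - ρ ^ (-1 : ℝ) * (1 - ρ ^ (-α)) * (1 + 1)) /
        (Real.log ρ ^ 2 * (1 + 1)) := by
  have hr : ρ ^ α ≠ 0 := (rpow_pos_of_pos hρ α).ne'
  have h2 : ρ ^ (-1 - 2 * α) = ρ⁻¹ * ((ρ ^ α)⁻¹) ^ 2 := by
    rw [← rpow_neg hρ.le, ← rpow_mul_natCast hρ.le, ← rpow_neg_one, ← rpow_add hρ]
    congr 1
    push_cast
    ring
  rw [h2, rpow_add_one hρ.ne', rpow_neg hρ.le, rpow_neg_one]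
  field_simp
  ring

lemma double_sum_closed_form {ρ : ℝ} (hρ : 0 < ρ) (hρ1 : ρ ≠ 1) {L N : ℕ} (hL2 : 2 ≤ L)
    (hN : N ≤ L) :
    (1 / (L : ℝ) ^ 2) *
        ∑ l ∈ Finset.Icc 1 N, ρ ^ (-(((l : ℝ) - 1) / ((L : ℝ) - 1))) *
          ∑ m ∈ Finset.Icc (l + 1) L, ρ ^ (-(((m : ℝ) - 1) / ((L : ℝ) - 1))) =
      (ρ ^ (-((L : ℝ) - 1)⁻¹) * (1 - ((ρ ^ (-((L : ℝ) - 1)⁻¹)) ^ N) ^ 2) -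
          (ρ ^ (-((L : ℝ) - 1)⁻¹)) ^ L * (1 - (ρ ^ (-((L : ℝ) - 1)⁻¹)) ^ N) *
            (1 + ρ ^ (-((L : ℝ) - 1)⁻¹))) /
        (((L : ℝ) * (1 - ρ ^ (-((L : ℝ) - 1)⁻¹))) ^ 2 * (1 + ρ ^ (-((L : ℝ) - 1)⁻¹))) := by
  have hlog : Real.log ρ ≠ 0 := Real.log_ne_zero_of_pos_of_ne_one hρ hρ1
  have hL2' : (2 : ℝ) ≤ L := by exact_mod_cast hL2
  have hL1 : (L : ℝ) - 1 ≠ 0 := by linarith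
  have hterm : ∀ l : ℕ, 1 ≤ l →
      ρ ^ (-(((l : ℝ) - 1) / ((L : ℝ) - 1))) = (ρ ^ (-((L : ℝ) - 1)⁻¹)) ^ (l - 1) := by
    intro l hl
    rw [← rpow_mul_natCast hρ.le, Nat.cast_sub hl, Nat.cast_one]
    congr 1
    ring
  have hsum : ∑ l ∈ Finset.Icc 1 N, ρ ^ (-(((l : ℝ) - 1) / ((L : ℝ) - 1))) *
        ∑ m ∈ Finset.Icc (l + 1) L, ρ ^ (-(((m : ℝ) - 1) / ((L : ℝ) - 1))) =
      ∑ l ∈ Finset.Icc 1 N, (ρ ^ (-((L : ℝ) - 1)⁻¹)) ^ (l - 1) *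
        ∑ m ∈ Finset.Icc (l + 1) L, (ρ ^ (-((L : ℝ) - 1)⁻¹)) ^ (m - 1) := by
    refine Finset.sum_congr rfl fun l hl => ?_
    rw [hterm l (Finset.mem_Icc.1 hl).1]
    congr 1
    refine Finset.sum_congr rfl fun m hm => hterm m ?_
    have := (Finset.mem_Icc.1 hm).1
    omega
  have hq_ne : 1 - ρ ^ (-((L : ℝ) - 1)⁻¹) ≠ 0 := by
    intro h
    have h' := congrArg Real.log (sub_eq_zero.1 h)
    rw [Real.log_one, Real.log_rpow hρ] at h'
    exact mul_ne_zero (neg_ne_zero.2 (inv_ne_zero hL1)) hlog h'.symm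
  have hq_pos : 0 < ρ ^ (-((L : ℝ) - 1)⁻¹) := rpow_pos_of_pos hρ _
  have hclosed := sum_pow_mul_sum_pow_mul (ρ ^ (-((L : ℝ) - 1)⁻¹)) hN
  rw [← hsum] at hclosed
  rw [← hclosed]
  have h1 : 1 + ρ ^ (-((L : ℝ) - 1)⁻¹) ≠ 0 := by linarith
  rw [mul_pow, mul_assoc, one_div_mul_eq_div,
    mul_div_mul_right _ _ (mul_ne_zero (pow_ne_zero 2 hq_ne) h1)]

/-- Double-sum limit Φ[W_k C_{D_j} C_{D_j}^H W_k]/(σ_k²σ_j²) (eq. (31)):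
(1/L²)·Σ_{l=1}^{⌊α̂L⌋} ρ^{-(l-1)/(L-1)} Σ_{m=l+1}^{L} ρ^{-(m-1)/(L-1)}
→ ρ^{-1-2α̂}(ρ^α̂−1)(ρ − 2ρ^α̂ + ρ^{α̂+1})/(2 (ln ρ)²). -/
theorem stmt_2 (ρ : ℝ) (hρ : 0 < ρ) (hρ1 : ρ ≠ 1) (α : ℝ) (hα : α ∈ Set.Ioc (0:ℝ) 1) :
    Tendsto (fun L : ℕ =>
        (1 / (L : ℝ) ^ 2) *
          ∑ l ∈ Finset.Icc 1 ⌊α * (L : ℝ)⌋₊,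
            ρ ^ (-(((l : ℝ) - 1) / ((L : ℝ) - 1))) *
              ∑ m ∈ Finset.Icc (l + 1) L,
                ρ ^ (-(((m : ℝ) - 1) / ((L : ℝ) - 1))))
      atTop
      (nhds (ρ ^ (-1 - 2 * α) * (ρ ^ α - 1) * (ρ - 2 * ρ ^ α + ρ ^ (α + 1)) /
        (2 * Real.log ρ ^ 2))) := by
  obtain ⟨hα0, hα1⟩ := hα
  have hlog : Real.log ρ ≠ 0 := Real.log_ne_zero_of_pos_of_ne_one hρ hρ1
  have hN := tendsto_rpow_neg_inv_pow hρ (N := fun L => ⌊α * (L : ℝ)⌋₊)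
    ((tendsto_nat_floor_mul_div_atTop hα0.le).comp tendsto_natCast_atTop_atTop)
  have hL : Tendsto (fun L : ℕ => (ρ ^ (-((L : ℝ) - 1)⁻¹)) ^ L) atTop (nhds (ρ ^ (-1 : ℝ))) := by
    refine tendsto_rpow_neg_inv_pow hρ (N := fun L => L) (tendsto_const_nhds.congr' ?_)
    filter_upwards [eventually_ge_atTop 1] with L hL
    exact (div_self (by positivity)).symm
  have hq : Tendsto (fun L : ℕ => ρ ^ (-((L : ℝ) - 1)⁻¹)) atTop (nhds 1) := by
    simpa [Function.comp_def] using ((continuous_const_rpow hρ.ne').tendsto _).comp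
      tendsto_inv_natCast_sub_one.neg
  have hq1 : Tendsto (fun L : ℕ => 1 + ρ ^ (-((L : ℝ) - 1)⁻¹)) atTop (nhds (1 + 1)) :=
    hq.const_add 1
  have key := ((hq.mul ((hN.pow 2).const_sub 1)).sub
    ((hL.mul (hN.const_sub 1)).mul hq1)).div
    (((tendsto_natCast_mul_one_sub_rpow hρ).pow 2).mul hq1) (by positivity)
  rw [limit_closed_form hρ]
  refine key.congr' ?_
  filter_upwards [eventually_ge_atTop 2] with L hL2
  have hfl : ⌊α * (L : ℝ)⌋₊ ≤ L :=
    Nat.floor_le_of_le (mul_le_of_le_one_left L.cast_nonneg hα1)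
  exact (double_sum_closed_form hρ hρ1 hL2 hfl).symm
end

section
/- Let ρ > 0 with ρ ≠ 1 and let α̂ ∈ (0,1]. Then the following identity holds: [ρ^{-2α̂}(ρ^α̂ − 1)²/(2(ln ρ)²) + ρ^{-1-2α̂}(ρ^α̂ − 1)(ρ − 2ρ^α̂ + ρ^{α̂+1})/(2(ln ρ)²)] / [((ρ^α̂ − 1)/(ρ^α̂ ln ρ))²] = (ρ − 1)·ρ^{α̂−1}/(ρ^α̂ − 1). In other words, the ratio of the sum of the two cross-interference limits to the square of the combining-gain limit equals μ(ρ,α̂) := (ρ−1)ρ^{α̂−1}/(ρ^α̂−1). -/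
open Real

/-- Algebraic core of Proposition 1: the ratio of the sum of the two
cross-interference limits to the square of the combining-gain limit equals
μ(ρ,α̂) = (ρ−1)ρ^{α̂−1}/(ρ^α̂−1). -/
theorem stmt_3 (ρ : ℝ) (hρ : 0 < ρ) (hρ1 : ρ ≠ 1) (α : ℝ) (hα : α ∈ Set.Ioc (0:ℝ) 1) :
    (ρ ^ (-(2 * α)) * (ρ ^ α - 1) ^ 2 / (2 * Real.log ρ ^ 2) +
        ρ ^ (-1 - 2 * α) * (ρ ^ α - 1) * (ρ - 2 * ρ ^ α + ρ ^ (α + 1)) /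
          (2 * Real.log ρ ^ 2)) /
      ((ρ ^ α - 1) / (ρ ^ α * Real.log ρ)) ^ 2 =
    (ρ - 1) * ρ ^ (α - 1) / (ρ ^ α - 1) := by
  have hlog : Real.log ρ ≠ 0 := Real.log_ne_zero_of_pos_of_ne_one hρ hρ1
  have ha : ρ ^ α ≠ 0 := (Real.rpow_pos_of_pos hρ α).ne'
  have ha1 : ρ ^ α - 1 ≠ 0 := fun h =>
    mul_ne_zero hα.1.ne' hlog <| by
      rw [← Real.log_rpow hρ, sub_eq_zero.mp h, Real.log_one]
  have hsq : ρ ^ (2 * α) = (ρ ^ α) ^ 2 := by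
    rw [two_mul, Real.rpow_add hρ, sq]
  rw [Real.rpow_neg hρ.le, Real.rpow_sub hρ, Real.rpow_sub hρ, Real.rpow_add hρ,
    Real.rpow_neg_one, Real.rpow_one, hsq]
  generalize ρ ^ α = a at ha ha1 ⊢
  have hρ0 : ρ ≠ 0 := hρ.ne'
  field_simp
  ring
end

section
/- Fix α̂ ∈ (0,1). Then the function ρ ↦ μ(ρ,α̂) = (ρ − 1)·ρ^{α̂−1}/(ρ^α̂ − 1) is strictly decreasing on (1,∞). -/
open Real

lemma mul_rpow_div_eq_inv_secant {α ρ : ℝ} (hρ : 1 < ρ) :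
    (ρ - 1) * ρ ^ (α - 1) / (ρ ^ α - 1) = (((ρ⁻¹) ^ α - 1 ^ α) / (ρ⁻¹ - 1))⁻¹ := by
  have h0 : 0 < ρ := by linarith
  have hp : ρ ^ α ≠ 0 := (rpow_pos_of_pos h0 α).ne'
  have h1 : (ρ⁻¹ - 1 : ℝ) = -((ρ - 1) / ρ) := by field_simp; ring
  have h2 : (ρ ^ α)⁻¹ - 1 = -((ρ ^ α - 1) / ρ ^ α) := by field_simp; ring
  rw [inv_rpow h0.le, one_rpow, rpow_sub_one h0.ne', inv_div, h1, h2, neg_div_neg_eq,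
    div_div_div_eq, mul_div_assoc', div_div]

/-- For fixed α̂ ∈ (0,1), the MAI factor ρ ↦ μ(ρ,α̂) = (ρ−1)ρ^{α̂−1}/(ρ^α̂−1)
is strictly decreasing on (1,∞) (Section III-E). -/
theorem stmt_6 (α : ℝ) (hα : α ∈ Set.Ioo (0:ℝ) 1) :
    StrictAntiOn (fun ρ : ℝ => (ρ - 1) * ρ ^ (α - 1) / (ρ ^ α - 1)) (Set.Ioi 1) := by
  intro a ha b hb hab
  have ha' : 1 < a := ha
  have hb' : 1 < b := hb
  have ha0 : 0 < a := by linarith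
  have hb0 : 0 < b := by linarith
  have ha1 : a⁻¹ < 1 := inv_lt_one_of_one_lt₀ ha'
  have hb1 : b⁻¹ < 1 := inv_lt_one_of_one_lt₀ hb'
  have hba : b⁻¹ < a⁻¹ := inv_strictAnti₀ ha0 hab
  have hsec := (strictConcaveOn_rpow hα.1 hα.2).secant_strict_mono (a := 1)
    (Set.mem_Ici.2 zero_le_one) (Set.mem_Ici.2 (inv_pos.2 hb0).le)
    (Set.mem_Ici.2 (inv_pos.2 ha0).le) hb1.ne ha1.ne hba
  have hpos : 0 < ((a⁻¹) ^ α - 1 ^ α) / (a⁻¹ - 1) :=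
    div_pos_of_neg_of_neg
      (sub_neg.2 (rpow_lt_rpow (inv_pos.2 ha0).le ha1 hα.1)) (sub_neg.2 ha1)
  simp only [mul_rpow_div_eq_inv_secant ha', mul_rpow_div_eq_inv_secant hb']
  exact inv_strictAnti₀ hpos hsec
end

section
/- Fix α̂ ∈ (0,1) and β with 0 < β ≤ min(α̂, 1−α̂). Then the limit as ρ → 1 (ρ > 0, ρ ≠ 1) of ν₁(ρ,α̂,β) := [ρ(ρ^β − 1)(4ρ^{2α̂} + 3ρ^β − 1) − 2ρ^{α̂+β}(ρ^α̂ + 3ρ − 1)·β·ln ρ] / [2(ρ^α̂ − 1)²·β·ρ^{1+β}·ln ρ] equals (2α̂² + 2α̂ − 4βα̂ + β²)/(2α̂²). -/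
open Filter Real

/-- The normalized Taylor remainder of `t ↦ exp (c * t)` at `0` tends to the next coefficient. -/
theorem tendsto_exp_mul_sub_sum_div_pow (c : ℝ) (n : ℕ) :
    Tendsto (fun t : ℝ =>
        (Real.exp (c * t) - ∑ i ∈ Finset.range n, (c * t) ^ i / (i.factorial : ℝ)) / t ^ n)
      (nhdsWithin 0 {0}ᶜ) (nhds (c ^ n / (n.factorial : ℝ))) := by
  have hc : Tendsto (fun t : ℝ => c * t) (nhds 0) (nhds 0) := by
    simpa using (continuous_const_mul c).tendsto (0 : ℝ)
  have ho := (Real.exp_sub_sum_range_succ_isLittleO_pow n).comp_tendsto hc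
  have hO : ((fun x : ℝ => x ^ n) ∘ fun t => c * t) =O[nhds 0] fun t : ℝ => t ^ n := by
    simp only [Function.comp_def, mul_pow]
    exact Asymptotics.isBigO_const_mul_self _ _ _
  have h := ((ho.trans_isBigO hO).tendsto_div_nhds_zero.mono_left
    (nhdsWithin_le_nhds (s := {0}ᶜ))).add_const (c ^ n / (n.factorial : ℝ))
  rw [zero_add] at h
  refine h.congr' ?_
  filter_upwards [self_mem_nhdsWithin] with t ht
  have ht : t ≠ 0 := ht
  have hn : (n.factorial : ℝ) ≠ 0 := by positivity
  simp only [Function.comp_def, Finset.sum_range_succ]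
  field_simp
  ring

/-- Flat-aPDP limit of the self-interference factor ν₁ (eq. (19a) → (21a)):
for 0 < β ≤ min(α̂, 1−α̂), ν₁(ρ,α̂,β) → (2α̂² + 2α̂ − 4βα̂ + β²)/(2α̂²) as ρ → 1. -/
theorem stmt_7 (α β : ℝ) (hα : α ∈ Set.Ioo (0:ℝ) 1) (hβ : 0 < β)
    (hβle : β ≤ min α (1 - α)) :
    Tendsto (fun ρ : ℝ =>
        (ρ * (ρ ^ β - 1) * (4 * ρ ^ (2 * α) + 3 * ρ ^ β - 1) -
            2 * ρ ^ (α + β) * (ρ ^ α + 3 * ρ - 1) * β * Real.log ρ) /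
          (2 * (ρ ^ α - 1) ^ 2 * β * ρ ^ (1 + β) * Real.log ρ))
      (nhdsWithin 1 {ρ : ℝ | 0 < ρ ∧ ρ ≠ 1})
      (nhds ((2 * α ^ 2 + 2 * α - 4 * β * α + β ^ 2) / (2 * α ^ 2))) := by
  have hα0 : α ≠ 0 := hα.1.ne'
  have hβ0 : β ≠ 0 := hβ.ne'
  have hlog : Tendsto Real.log (nhdsWithin 1 {ρ : ℝ | 0 < ρ ∧ ρ ≠ 1})
      (nhdsWithin 0 {0}ᶜ) := by
    refine tendsto_nhdsWithin_of_tendsto_nhds_of_eventually_within _ ?_ ?_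
    · simpa using (Real.continuousAt_log one_ne_zero).tendsto.mono_left
        (nhdsWithin_le_nhds (s := {ρ : ℝ | 0 < ρ ∧ ρ ≠ 1}))
    · filter_upwards [self_mem_nhdsWithin] with ρ hρ
      exact Real.log_ne_zero_of_pos_of_ne_one hρ.1 hρ.2
  have T := tendsto_exp_mul_sub_sum_div_pow
  have hnum := (((((T (β + 2 * α) 3).const_mul 4).add ((T (2 * β) 3).const_mul 3)).sub
    ((T β 3).const_mul 4)).sub ((T (2 * α) 3).const_mul 4)).sub
    ((((T (2 * α + β - 1) 2).add ((T (α + β) 2).const_mul 3)).sub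
      (T (α + β - 1) 2)).const_mul (2 * β))
  have hden := (((T α 1).pow 2).mul (T β 0)).const_mul (2 * β)
  have h := (hnum.div hden (by simp [hα0, hβ0])).comp hlog
  have hlim : (2 * α ^ 2 + 2 * α - 4 * β * α + β ^ 2) / (2 * α ^ 2) =
      (4 * ((β + 2 * α) ^ 3 / ((3).factorial : ℝ)) + 3 * ((2 * β) ^ 3 / ((3).factorial : ℝ)) -
        4 * (β ^ 3 / ((3).factorial : ℝ)) - 4 * ((2 * α) ^ 3 / ((3).factorial : ℝ)) -
        2 * β * ((2 * α + β - 1) ^ 2 / ((2).factorial : ℝ) +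
          3 * ((α + β) ^ 2 / ((2).factorial : ℝ)) - (α + β - 1) ^ 2 / ((2).factorial : ℝ))) /
      (2 * β * ((α ^ 1 / ((1).factorial : ℝ)) ^ 2 * (β ^ 0 / ((0).factorial : ℝ)))) := by
    norm_num [Nat.factorial]
    field_simp
    ring
  rw [hlim]
  refine h.congr' ?_
  filter_upwards [self_mem_nhdsWithin] with ρ hρ
  have ht : Real.log ρ ≠ 0 := Real.log_ne_zero_of_pos_of_ne_one hρ.1 hρ.2
  obtain ⟨t, rfl⟩ : ∃ t, ρ = Real.exp t := ⟨Real.log ρ, (Real.exp_log hρ.1).symm⟩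
  rw [Real.log_exp] at ht
  have hA : Real.exp (α * t) - 1 ≠ 0 := by
    rw [sub_ne_zero, Ne, Real.exp_eq_one_iff]
    exact mul_ne_zero hα0 ht
  have e1 : Real.exp ((β + 2 * α) * t) = Real.exp (β * t) * Real.exp (α * t) ^ 2 := by
    rw [← Real.exp_nat_mul, ← Real.exp_add]; congr 1; push_cast; ring
  have e2 : Real.exp (2 * β * t) = Real.exp (β * t) ^ 2 := by
    rw [← Real.exp_nat_mul]; congr 1; push_cast; ring
  have e3 : Real.exp (2 * α * t) = Real.exp (α * t) ^ 2 := by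
    rw [← Real.exp_nat_mul]; congr 1; push_cast; ring
  have e4 : Real.exp ((2 * α + β - 1) * t) =
      Real.exp (α * t) ^ 2 * Real.exp (β * t) / Real.exp t := by
    rw [← Real.exp_nat_mul, ← Real.exp_add, ← Real.exp_sub]; congr 1; push_cast; ring
  have e5 : Real.exp ((α + β) * t) = Real.exp (α * t) * Real.exp (β * t) := by
    rw [← Real.exp_add]; congr 1; ring
  have e6 : Real.exp ((α + β - 1) * t) = Real.exp (α * t) * Real.exp (β * t) / Real.exp t := by
    rw [← Real.exp_add, ← Real.exp_sub]; congr 1; ring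
  have e7 : Real.exp ((1 + β) * t) = Real.exp t * Real.exp (β * t) := by
    rw [← Real.exp_add]; congr 1; ring
  have p (x : ℝ) : Real.exp t ^ x = Real.exp (x * t) := by rw [← Real.exp_mul, mul_comm]
  simp only [Function.comp_def, Pi.div_apply, Real.log_exp, p, Finset.sum_range_succ,
    Finset.sum_range_zero, e1, e2, e3, e4, e5, e6, e7]
  have hE := Real.exp_ne_zero t
  have hB := Real.exp_ne_zero (β * t)
  generalize Real.exp (α * t) = A at *
  generalize Real.exp (β * t) = B at *
  generalize Real.exp t = R at *
  norm_num [Nat.factorial]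
  field_simp
  ring
end

section
/- Fix α̂ ∈ (0,1/2] and β with α̂ ≤ β ≤ 1−α̂ and β > 0. Then the limit as ρ → 1 (ρ > 0, ρ ≠ 1) of ν₂(ρ,α̂,β) := [ρ(4ρ^β − 1)(ρ^{2α̂} − 1) − 2ρ^{α̂+β}(3ρα̂ − β + ρ^α̂·β)·ln ρ] / [2(ρ^α̂ − 1)²·β·ρ^{1+β}·ln ρ] equals (1/2)·((2−β)/α̂ + α̂/β − 1). -/
open Filter Real

/-- The normalised cubic Taylor remainder of `t ↦ exp (c * t)` at `0`. -/
noncomputable def expCubicRemainder (c t : ℝ) : ℝ :=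
  (Real.exp (c * t) - 1 - c * t - (c * t) ^ 2 / 2) / t ^ 3

theorem exp_mul_eq_add_cubicRemainder (c : ℝ) {t : ℝ} (ht : t ≠ 0) :
    Real.exp (c * t) = 1 + c * t + (c * t) ^ 2 / 2 + t ^ 3 * expCubicRemainder c t := by
  unfold expCubicRemainder
  field_simp
  ring

theorem tendsto_expCubicRemainder (c : ℝ) :
    Tendsto (expCubicRemainder c) (nhdsWithin 0 {0}ᶜ) (nhds (c ^ 3 / 6)) := by
  have hc : Tendsto (fun t : ℝ => c * t) (nhds 0) (nhds 0) := by
    simpa using (continuous_const_mul c).tendsto 0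
  have hlittle := (Real.exp_sub_sum_range_succ_isLittleO_pow 3).comp_tendsto hc
  have hbig : (fun t : ℝ => (c * t) ^ 3) =O[nhds 0] fun t : ℝ => t ^ 3 := by
    simp only [mul_pow]
    exact Asymptotics.isBigO_const_mul_self _ _ _
  have hquot := ((hlittle.trans_isBigO hbig).tendsto_div_nhds_zero.mono_left
    (nhdsWithin_le_nhds (s := {0}ᶜ))).add_const (c ^ 3 / 6)
  rw [zero_add] at hquot
  refine hquot.congr' ?_
  filter_upwards [self_mem_nhdsWithin] with t ht
  have ht0 : t ≠ 0 := ht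
  simp only [expCubicRemainder, Function.comp, Finset.sum_range_succ, Finset.sum_range_zero,
    Nat.factorial]
  push_cast
  field_simp
  ring

theorem tendsto_log_nhdsWithin_one :
    Tendsto Real.log (nhdsWithin 1 {ρ : ℝ | 0 < ρ ∧ ρ ≠ 1}) (nhdsWithin 0 {0}ᶜ) := by
  refine tendsto_nhdsWithin_iff.2 ⟨?_, ?_⟩
  · simpa using (Real.continuousAt_log one_ne_zero).tendsto.mono_left nhdsWithin_le_nhds
  · filter_upwards [self_mem_nhdsWithin] with ρ hρ
    exact Real.log_ne_zero_of_pos_of_ne_one hρ.1 hρ.2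

/-- Cancellation of the common factor `t ^ 3` in the quotient, where `a`, `b`, `e` stand for
`exp (α * t)`, `exp (β * t)`, `exp t` and `b'`, `e'` for the inverses of `b`, `e`. -/
theorem quotient_eq_of_expansions {α β t a b e b' e' A u₁ v₁ w u v : ℝ}
    (ht : t ≠ 0) (hb : b ≠ 0) (he : e ≠ 0)
    (hbb : b * b' = 1) (hee : e * e' = 1) (hu₁ : u₁ = α ^ 2 / 2 + t * A)
    (hu : u = α + t * u₁) (hv : v = β + t * v₁) (ha : a = 1 + t * u)
    (hb' : b' = 1 - t * v) (he' : e' = 1 - t * w) :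
    (e * (4 * b - 1) * (a ^ 2 - 1) - 2 * (a * b) * (3 * e * α - β + a * β) * t) /
        (2 * (a - 1) ^ 2 * β * (e * b) * t) =
      (6 * A + 3 * t * u₁ ^ 2 + 2 * u * v₁ + v * u ^ 2 - 2 * β * u ^ 2 + 2 * β * u * w
        + 2 * β * t * u ^ 2 * w) / (2 * β * u ^ 2) := by
  have hfactor : e * (4 * b - 1) * (a ^ 2 - 1) - 2 * (a * b) * (3 * e * α - β + a * β) * t =
      e * b * ((4 - b') * (a ^ 2 - 1) - 2 * a * (3 * α + β * e' * (a - 1)) * t) := by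
    linear_combination e * (a ^ 2 - 1) * hbb + 2 * a * b * β * (a - 1) * t * hee
  have hcubic : (4 - b') * (a ^ 2 - 1) - 2 * a * (3 * α + β * e' * (a - 1)) * t =
      t ^ 3 * (6 * A + 3 * t * u₁ ^ 2 + 2 * u * v₁ + v * u ^ 2 - 2 * β * u ^ 2 + 2 * β * u * w
        + 2 * β * t * u ^ 2 * w) := by
    subst hb' he' ha hv hu hu₁
    ring
  have hden : 2 * (a - 1) ^ 2 * β * (e * b) * t = e * b * (t ^ 3 * (2 * β * u ^ 2)) := by
    subst ha
    ring
  rw [hfactor, hcubic, hden, mul_div_mul_left _ _ (mul_ne_zero he hb),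
    mul_div_mul_left _ _ (pow_ne_zero 3 ht)]

/-- Flat-aPDP limit of the self-interference factor ν₂ (eq. (19b) → (21b)):
for α̂ ≤ 1/2, α̂ ≤ β ≤ 1−α̂, β > 0,
ν₂(ρ,α̂,β) → (1/2)·((2−β)/α̂ + α̂/β − 1) as ρ → 1. -/
theorem stmt_8 (α β : ℝ) (hα : α ∈ Set.Ioc (0:ℝ) (1/2)) (hβ : 0 < β)
    (hβ1 : α ≤ β) (hβ2 : β ≤ 1 - α) :
    Tendsto (fun ρ : ℝ =>
        (ρ * (4 * ρ ^ β - 1) * (ρ ^ (2 * α) - 1) -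
            2 * ρ ^ (α + β) * (3 * ρ * α - β + ρ ^ α * β) * Real.log ρ) /
          (2 * (ρ ^ α - 1) ^ 2 * β * ρ ^ (1 + β) * Real.log ρ))
      (nhdsWithin 1 {ρ : ℝ | 0 < ρ ∧ ρ ≠ 1})
      (nhds ((1 / 2) * ((2 - β) / α + α / β - 1))) := by
  have hα0 : α ≠ 0 := hα.1.ne'
  have hβ0 : β ≠ 0 := hβ.ne'
  let A : ℝ → ℝ := expCubicRemainder α
  let u₁ : ℝ → ℝ := fun t => α ^ 2 / 2 + t * A t
  let u : ℝ → ℝ := fun t => α + t * u₁ t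
  let v₁ : ℝ → ℝ := fun t => -(β ^ 2 / 2) - t * expCubicRemainder (-β) t
  let v : ℝ → ℝ := fun t => β + t * v₁ t
  let w : ℝ → ℝ := fun t => 1 - t / 2 - t ^ 2 * expCubicRemainder (-1) t
  have hid : Tendsto (fun t : ℝ => t) (nhdsWithin 0 {0}ᶜ) (nhds 0) :=
    tendsto_id.mono_left nhdsWithin_le_nhds
  have hA : Tendsto A (nhdsWithin 0 {0}ᶜ) (nhds (α ^ 3 / 6)) := tendsto_expCubicRemainder α
  have hu₁ : Tendsto u₁ (nhdsWithin 0 {0}ᶜ) (nhds (α ^ 2 / 2)) := by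
    simpa using (hid.mul hA).const_add (α ^ 2 / 2)
  have hu : Tendsto u (nhdsWithin 0 {0}ᶜ) (nhds α) := by
    simpa using (hid.mul hu₁).const_add α
  have hv₁ : Tendsto v₁ (nhdsWithin 0 {0}ᶜ) (nhds (-(β ^ 2 / 2))) := by
    simpa using (hid.mul (tendsto_expCubicRemainder (-β))).const_sub (-(β ^ 2 / 2))
  have hv : Tendsto v (nhdsWithin 0 {0}ᶜ) (nhds β) := by
    simpa using (hid.mul hv₁).const_add β
  have hw : Tendsto w (nhdsWithin 0 {0}ᶜ) (nhds 1) := by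
    simpa using ((hid.div_const 2).const_sub 1).sub
      ((hid.pow 2).mul (tendsto_expCubicRemainder (-1)))
  have hlim := (((((((hA.const_mul 6).add ((hid.const_mul 3).mul (hu₁.pow 2))).add
    ((hu.const_mul 2).mul hv₁)).add (hv.mul (hu.pow 2))).sub ((hu.pow 2).const_mul (2 * β))).add
    ((hu.const_mul (2 * β)).mul hw)).add
    (((hid.const_mul (2 * β)).mul (hu.pow 2)).mul hw)).div
    ((hu.pow 2).const_mul (2 * β)) (by positivity)
  have hval := hlim.comp tendsto_log_nhdsWithin_one
  rw [show (1 / 2) * ((2 - β) / α + α / β - 1) = (6 * (α ^ 3 / 6) + 3 * 0 * (α ^ 2 / 2) ^ 2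
      + 2 * α * -(β ^ 2 / 2) + β * α ^ 2 - 2 * β * α ^ 2 + 2 * β * α * 1
      + 2 * β * 0 * α ^ 2 * 1) / (2 * β * α ^ 2) by field_simp; ring]
  refine hval.congr' ?_
  filter_upwards [self_mem_nhdsWithin] with ρ hρ
  have ht : Real.log ρ ≠ 0 := Real.log_ne_zero_of_pos_of_ne_one hρ.1 hρ.2
  have hpos := hρ.1
  rw [mul_comm 2 α, Real.rpow_mul hpos.le, Real.rpow_two, Real.rpow_add hpos, Real.rpow_add hpos,
    Real.rpow_one]
  refine (quotient_eq_of_expansions (b' := ρ ^ (-β)) (e' := ρ ^ (-1 : ℝ)) (u := u (Real.log ρ))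
    (v := v (Real.log ρ))
    ht (Real.rpow_pos_of_pos hpos β).ne' hpos.ne' ?_ ?_ rfl rfl rfl ?_ ?_ ?_).symm
  · rw [← Real.rpow_add hpos, add_neg_cancel, Real.rpow_zero]
  · rw [Real.rpow_neg_one, mul_inv_cancel₀ hpos.ne']
  · rw [Real.rpow_def_of_pos hpos, mul_comm, exp_mul_eq_add_cubicRemainder α ht]
    simp only [u, u₁, A]
    ring
  · rw [Real.rpow_def_of_pos hpos, mul_comm, exp_mul_eq_add_cubicRemainder (-β) ht]
    simp only [v, v₁]
    ring
  · rw [Real.rpow_def_of_pos hpos, mul_comm, exp_mul_eq_add_cubicRemainder (-1) ht]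
    simp only [w]
    ring
end

section
/- Fix α̂ ∈ [1/2,1] and β with 1−α̂ ≤ β ≤ α̂ and β > 0. Then the limit as ρ → 1 (ρ > 0, ρ ≠ 1) of ν₃(ρ,α̂,β) := [−4ρ^{2+2α̂} − 4ρ^{2+β} + ρ^{2(α̂+β)} + 4ρ^{2+2α̂+β} + 3ρ^{2+2β} − 2ρ^{1+α̂+β}(α̂ + 3ρβ + ρ^α̂·β − 1)·ln ρ] / [2(ρ^α̂ − 1)²·β·ρ^{2+β}·ln ρ] equals [α̂³ + α̂²(9β − 3) + α̂(3 − 9β²) + 4β³ − 3β² + 3β − 1]/(6βα̂²). -/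
open Filter Real

/-- The `n`-th Taylor remainder of `t ↦ exp (k * t)` at `0` is equivalent to `k ^ n / n! * t ^ n`. -/
theorem tendsto_exp_mul_taylor_remainder_div_pow (k : ℝ) (n : ℕ) :
    Tendsto (fun t : ℝ =>
        (exp (k * t) - ∑ i ∈ Finset.range n, (k * t) ^ i / (i.factorial : ℝ)) / t ^ n)
      (nhdsWithin 0 {0}ᶜ) (nhds (k ^ n / (n.factorial : ℝ))) := by
  have hk : Tendsto (fun t : ℝ => k * t) (nhdsWithin 0 {0}ᶜ) (nhds 0) :=
    ((continuous_const_mul k).tendsto' 0 0 (mul_zero k)).mono_left nhdsWithin_le_nhds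
  have ho := (Real.exp_sub_sum_range_succ_isLittleO_pow n).comp_tendsto hk
  have hO : ((fun x : ℝ => x ^ n) ∘ fun t : ℝ => k * t) =O[nhdsWithin 0 {0}ᶜ]
      fun t : ℝ => t ^ n := by
    simpa only [Function.comp_def, mul_pow] using
      Asymptotics.isBigO_const_mul_self (k ^ n) (fun t : ℝ => t ^ n) (nhdsWithin 0 {0}ᶜ)
  have h := (ho.trans_isBigO hO).tendsto_div_nhds_zero.add_const (k ^ n / (n.factorial : ℝ))
  rw [zero_add] at h
  refine h.congr' ?_
  filter_upwards [self_mem_nhdsWithin] with t ht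
  have ht' : t ≠ 0 := ht
  simp only [Function.comp_apply, Finset.sum_range_succ, mul_pow]
  field_simp
  ring

/-- Flat-aPDP limit of the self-interference factor ν₃ (eq. (19c) → (21c)):
for α̂ ∈ [1/2,1], 1−α̂ ≤ β ≤ α̂, β > 0, as ρ → 1,
ν₃(ρ,α̂,β) → [α̂³ + α̂²(9β−3) + α̂(3−9β²) + 4β³ − 3β² + 3β − 1]/(6βα̂²). -/
theorem stmt_9 (α β : ℝ) (hα : α ∈ Set.Icc (1/2 : ℝ) 1) (hβ : 0 < β)
    (hβ1 : 1 - α ≤ β) (hβ2 : β ≤ α) :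
    Tendsto (fun ρ : ℝ =>
        (-4 * ρ ^ (2 + 2 * α) - 4 * ρ ^ (2 + β) + ρ ^ (2 * (α + β)) +
            4 * ρ ^ (2 + 2 * α + β) + 3 * ρ ^ (2 + 2 * β) -
            2 * ρ ^ (1 + α + β) * (α + 3 * ρ * β + ρ ^ α * β - 1) * Real.log ρ) /
          (2 * (ρ ^ α - 1) ^ 2 * β * ρ ^ (2 + β) * Real.log ρ))
      (nhdsWithin 1 {ρ : ℝ | 0 < ρ ∧ ρ ≠ 1})
      (nhds ((α ^ 3 + α ^ 2 * (9 * β - 3) + α * (3 - 9 * β ^ 2) +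
        4 * β ^ 3 - 3 * β ^ 2 + 3 * β - 1) / (6 * β * α ^ 2))) := by
  have hα0 : α ≠ 0 := by linarith [hα.1]
  have hβ0 : β ≠ 0 := hβ.ne'
  have cubic (k : ℝ) := tendsto_exp_mul_taylor_remainder_div_pow k 3
  have quadratic (k : ℝ) := tendsto_exp_mul_taylor_remainder_div_pow k 2
  have numerator := ((((((cubic (2 + 2 * α)).const_mul (-4)).sub
    ((cubic (2 + β)).const_mul 4)).add (cubic (2 * (α + β)))).add
    ((cubic (2 + 2 * α + β)).const_mul 4)).add ((cubic (2 + 2 * β)).const_mul 3)).sub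
    (((((quadratic (1 + α + β)).const_mul (α - 1)).add
      ((quadratic (2 + α + β)).const_mul (3 * β))).add
      ((quadratic (1 + 2 * α + β)).const_mul β)).const_mul 2)
  have exp_factor : Tendsto (fun t : ℝ => exp ((2 + β) * t)) (nhdsWithin 0 {0}ᶜ) (nhds 1) :=
    (Continuous.tendsto' (by fun_prop) 0 1 (by simp)).mono_left nhdsWithin_le_nhds
  have denominator := ((((tendsto_exp_mul_taylor_remainder_div_pow α 1).pow 2).const_mul
    (2 * β)).mul exp_factor)
  have quotient := numerator.div denominator (by simp [hα0, hβ0])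
  have log_tendsto : Tendsto Real.log (nhdsWithin 1 {ρ : ℝ | 0 < ρ ∧ ρ ≠ 1})
      (nhdsWithin 0 {0}ᶜ) := by
    refine tendsto_nhdsWithin_iff.2 ⟨?_, ?_⟩
    · simpa using (Real.continuousAt_log one_ne_zero).tendsto.mono_left
        (nhdsWithin_le_nhds (s := {ρ : ℝ | 0 < ρ ∧ ρ ≠ 1}))
    · filter_upwards [self_mem_nhdsWithin] with ρ hρ
      exact Real.log_ne_zero_of_pos_of_ne_one hρ.1 hρ.2
  convert (quotient.comp log_tendsto).congr' ?_ using 2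
  · simp only [Nat.factorial]
    push_cast
    field_simp
    ring
  · filter_upwards [self_mem_nhdsWithin] with ρ hρ
    have ht : Real.log ρ ≠ 0 := Real.log_ne_zero_of_pos_of_ne_one hρ.1 hρ.2
    obtain ⟨t, rfl⟩ : ∃ t, exp t = ρ := ⟨Real.log ρ, Real.exp_log hρ.1⟩
    rw [Real.log_exp] at ht
    have shift₁ : exp ((2 + α + β) * t) = exp ((1 + α + β) * t) * exp t := by
      rw [← Real.exp_add]; ring_nf
    have shift₂ : exp ((1 + 2 * α + β) * t) = exp ((1 + α + β) * t) * exp (α * t) := by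
      rw [← Real.exp_add]; ring_nf
    simp only [Function.comp_apply, Real.log_exp, ← Real.exp_mul, Pi.div_apply,
      mul_comm t, Finset.sum_range_succ, Finset.sum_range_zero, Nat.factorial, shift₁, shift₂]
    rw [← mul_div_mul_right _ _ (pow_ne_zero 3 ht)]
    congr 1
    · push_cast
      field_simp
      ring
    · push_cast
      field_simp
      ring
end

section
/- Fix α̂ ∈ (0,1] and β ≥ 1. Then the limit as ρ → 1 (ρ > 0, ρ ≠ 1) of ν₅(ρ,α̂,β) := [2ρ(ρ^{2α̂} − 1) − (ρ^α̂ + α̂ + 3ρα̂ − 1)·ρ^α̂·ln ρ] / [(ρ^α̂ − 1)²·β·ρ·ln ρ] equals (4α̂² − 3α̂ + 3)/(6βα̂). -/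
open Filter Real

/-- The cubic remainder quotient of the exponential. -/
noncomputable def expRem (t : ℝ) : ℝ := (exp t - 1 - t - t ^ 2 / 2) / t ^ 3

theorem exp_eq_expRem {t : ℝ} (ht : t ≠ 0) :
    exp t = 1 + t + t ^ 2 / 2 + t ^ 3 * expRem t := by
  unfold expRem
  field_simp
  ring

theorem tendsto_expRem : Tendsto expRem (nhdsWithin 0 {0}ᶜ) (nhds (1 / 6)) := by
  rw [tendsto_iff_norm_sub_tendsto_zero]
  have h0 : Tendsto (fun t : ℝ => |t|) (nhdsWithin 0 {0}ᶜ) (nhds 0) := by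
    simpa using (continuous_abs.tendsto (0 : ℝ)).mono_left nhdsWithin_le_nhds
  refine squeeze_zero' (Eventually.of_forall fun _ => norm_nonneg _) ?_ h0
  filter_upwards [self_mem_nhdsWithin, h0.eventually (gt_mem_nhds one_pos)] with t ht h1
  have ht : t ≠ 0 := ht
  have hb := exp_bound h1.le (n := 4) (by norm_num)
  have h3 : 0 < |t| ^ 3 := by positivity
  have he : exp t - ∑ m ∈ Finset.range 4, t ^ m / (m.factorial : ℝ) =
      (expRem t - 1 / 6) * t ^ 3 := by
    rw [exp_eq_expRem ht]
    simp [Finset.sum_range_succ, Nat.factorial]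
    ring
  rw [he, abs_mul, abs_pow] at hb
  norm_num [Nat.factorial] at hb
  rw [norm_eq_abs]
  refine le_of_mul_le_mul_right (hb.trans ?_) h3
  nlinarith [mul_pos h3 (abs_pos.mpr ht)]

/-- The numerator of the self-interference factor at `exp t`, divided by `t ^ 3`, in terms of
`r = expRem t` and `s = expRem (a * t)`. -/
noncomputable def numQuot (a t r s : ℝ) : ℝ :=
    (1/2) * a - (1/2) * a ^ 2 + 4 * a ^ 3 * s + t * a * r + (1/2) * t * a ^ 2 +
    (-1/2) * t * a ^ 3 + 3 * t * a ^ 3 * s + (1/2) * t * a ^ 4 + t ^ 2 * a ^ 2 * r +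
    (1/4) * t ^ 2 * a ^ 3 + 2 * t ^ 2 * a ^ 3 * s + (1/4) * t ^ 2 * a ^ 4 +
    (-1) * t ^ 2 * a ^ 4 * s + 2 * t ^ 2 * a ^ 5 * s + (1/2) * t ^ 3 * a ^ 3 * r +
    4 * t ^ 3 * a ^ 3 * r * s + (1/4) * t ^ 3 * a ^ 4 + (1/2) * t ^ 3 * a ^ 4 * s +
    t ^ 3 * a ^ 5 * s + 2 * t ^ 3 * a ^ 6 * s ^ 2 + (1/2) * t ^ 4 * a ^ 4 * r +
    t ^ 4 * a ^ 4 * r * s + t ^ 4 * a ^ 5 * s + t ^ 4 * a ^ 6 * s ^ 2 +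
    2 * t ^ 5 * a ^ 5 * r * s + t ^ 5 * a ^ 6 * s ^ 2 + 2 * t ^ 6 * a ^ 6 * r * s ^ 2

theorem numerator_eq_numQuot {a t : ℝ} (ha : a ≠ 0) (ht : t ≠ 0) :
    2 * exp t * (exp (a * t) ^ 2 - 1) -
        (exp (a * t) + a + 3 * exp t * a - 1) * exp (a * t) * t =
      t ^ 3 * numQuot a t (expRem t) (expRem (a * t)) := by
  rw [exp_eq_expRem ht, exp_eq_expRem (mul_ne_zero ha ht), numQuot]
  ring

theorem denominator_eq {a t : ℝ} (ha : a ≠ 0) (ht : t ≠ 0) (b : ℝ) :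
    (exp (a * t) - 1) ^ 2 * b * exp t * t =
      t ^ 3 * (a ^ 2 * (1 + a * t / 2 + (a * t) ^ 2 * expRem (a * t)) ^ 2 * b * exp t) := by
  rw [exp_eq_expRem (mul_ne_zero ha ht)]
  ring

theorem tendsto_log_nhdsNE :
    Tendsto log (nhdsWithin 1 {ρ : ℝ | 0 < ρ ∧ ρ ≠ 1}) (nhdsWithin 0 {0}ᶜ) := by
  refine tendsto_nhdsWithin_iff.mpr ⟨?_, ?_⟩
  · simpa using (continuousAt_log one_ne_zero).tendsto.mono_left nhdsWithin_le_nhds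
  · filter_upwards [self_mem_nhdsWithin] with ρ hρ
    exact log_ne_zero_of_pos_of_ne_one hρ.1 hρ.2

/-- Flat-aPDP limit of the self-interference factor ν₅ (eq. (19e) → (21e)):
for α̂ ∈ (0,1] and β ≥ 1, as ρ → 1,
ν₅(ρ,α̂,β) → (4α̂² − 3α̂ + 3)/(6βα̂). -/
theorem stmt_11 (α β : ℝ) (hα : α ∈ Set.Ioc (0:ℝ) 1) (hβ : 1 ≤ β) :
    Tendsto (fun ρ : ℝ =>
        (2 * ρ * (ρ ^ (2 * α) - 1) -
            (ρ ^ α + α + 3 * ρ * α - 1) * ρ ^ α * Real.log ρ) /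
          ((ρ ^ α - 1) ^ 2 * β * ρ * Real.log ρ))
      (nhdsWithin 1 {ρ : ℝ | 0 < ρ ∧ ρ ≠ 1})
      (nhds ((4 * α ^ 2 - 3 * α + 3) / (6 * β * α))) := by
  have ha : α ≠ 0 := hα.1.ne'
  have hb : β ≠ 0 := (one_pos.trans_le hβ).ne'
  have hid : Tendsto (fun t : ℝ => t) (nhdsWithin 0 {0}ᶜ) (nhds 0) := nhdsWithin_le_nhds
  have hmul : Tendsto (fun t : ℝ => α * t) (nhdsWithin 0 {0}ᶜ) (nhdsWithin 0 {0}ᶜ) := by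
    refine tendsto_nhdsWithin_iff.mpr ⟨by simpa using hid.const_mul α, ?_⟩
    filter_upwards [self_mem_nhdsWithin] with t ht
    exact mul_ne_zero ha ht
  have hs := tendsto_expRem.comp hmul
  have htriple := hid.prodMk_nhds (tendsto_expRem.prodMk_nhds hs)
  have hcont : ContinuousAt (fun p : ℝ × ℝ × ℝ => numQuot α p.1 p.2.1 p.2.2 /
      (α ^ 2 * (1 + α * p.1 / 2 + (α * p.1) ^ 2 * p.2.2) ^ 2 * β * exp p.1))
      (0, 1 / 6, 1 / 6) := by
    unfold numQuot
    refine ContinuousAt.div (by fun_prop) (by fun_prop) ?_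
    simp [ha, hb]
  have hlim := (hcont.tendsto.comp htriple).comp tendsto_log_nhdsNE
  have hval : numQuot α 0 (1 / 6) (1 / 6) /
      (α ^ 2 * (1 + α * 0 / 2 + (α * 0) ^ 2 * (1 / 6)) ^ 2 * β * exp 0) =
      (4 * α ^ 2 - 3 * α + 3) / (6 * β * α) := by
    simp only [numQuot, exp_zero]
    field_simp
    ring
  rw [← hval]
  refine hlim.congr' ?_
  filter_upwards [self_mem_nhdsWithin] with ρ ⟨hρ, hρ1⟩
  have hlog : log ρ ≠ 0 := log_ne_zero_of_pos_of_ne_one hρ hρ1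
  have hpow : ρ ^ α = exp (α * log ρ) := by rw [rpow_def_of_pos hρ, mul_comm]
  have hpow2 : ρ ^ (2 * α) = exp (α * log ρ) ^ 2 := by
    rw [← hpow, mul_comm, rpow_mul hρ.le, rpow_two]
  have hnum := numerator_eq_numQuot ha hlog
  have hden := denominator_eq ha hlog β
  rw [exp_log hρ] at hnum hden
  rw [hpow2, hpow, hnum, hden, mul_div_mul_left _ _ (pow_ne_zero 3 hlog)]
  simp only [Function.comp_apply, exp_log hρ]
end

section
/- Let ρ > 1, α̂ ∈ (0,1], and β ≥ 1. For each integer L ≥ 2 set N := ⌊βL⌋ and P := ⌊α̂L⌋, and define S_L := (1/L²)·Σ_{i=1}^{L−1} (min(L−i, N)/N) · Σ_{l=1}^{i} ρ^{−(L+2l−i−2)/(L−1)} · (𝟙[l ≤ P] + 𝟙[l ≤ P − L + i])², where 𝟙[·] denotes the indicator (value 1 if the condition holds, 0 otherwise). Then S_L converges, as L → ∞, to [2ρ(ρ^{2α̂} − 1) − (ρ^α̂ + α̂ + 3ρα̂ − 1)·ρ^α̂·ln ρ] / (ρ^{2α̂+1}·β·(ln ρ)³). -/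
open Filter Real

/-- The arithmetico-geometric sum `∑ j < n, j * x ^ j`. -/
noncomputable def arithGeomSum (n : ℕ) (x : ℝ) : ℝ := ∑ j ∈ Finset.range n, (j : ℝ) * x ^ j

lemma arithGeomSum_mul_sq (n : ℕ) (x : ℝ) :
    arithGeomSum n x * (1 - x) ^ 2 = x * (1 - x ^ n) - n * x ^ n * (1 - x) := by
  induction n with
  | zero => simp [arithGeomSum]
  | succ k ih =>
    rw [arithGeomSum, Finset.sum_range_succ, add_mul, ← arithGeomSum, ih]
    push_cast
    ring

lemma one_sub_sq_mul_sum_Icc (r : ℝ) (m : ℕ) :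
    (1 - r ^ 2) * ∑ l ∈ Finset.Icc 1 m, (r ^ 2) ^ (l - 1) = 1 - (r ^ 2) ^ m := by
  induction m with
  | zero => simp
  | succ k ih =>
    rw [Finset.sum_Icc_succ_top (by omega), mul_add, ih]
    simp only [Nat.add_sub_cancel]
    ring

lemma tendsto_div_natCast_sub_one {f : ℕ → ℝ} {μ : ℝ}
    (h : Tendsto (fun L : ℕ => f L / L) atTop (nhds μ)) :
    Tendsto (fun L : ℕ => f L / ((L : ℝ) - 1)) atTop (nhds μ) := by
  have h1 : Tendsto (fun L : ℕ => 1 - 1 / (L : ℝ)) atTop (nhds (1 - 0)) :=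
    tendsto_const_nhds.sub tendsto_one_div_atTop_nhds_zero_nat
  have h2 := h.div h1 (by norm_num)
  rw [sub_zero, div_one] at h2
  refine h2.congr' ?_
  filter_upwards [eventually_ge_atTop 2] with L hL
  have hL' : (2 : ℝ) ≤ L := by exact_mod_cast hL
  have : (L : ℝ) ≠ 0 := by positivity
  have h3 : (L : ℝ) - 1 ≠ 0 := by linarith
  simp only [Pi.div_apply]
  field_simp

lemma tendsto_exp_neg_div_pow (s : ℝ) {n : ℕ → ℕ} {μ : ℝ}
    (h : Tendsto (fun L : ℕ => (n L : ℝ) / L) atTop (nhds μ)) :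
    Tendsto (fun L : ℕ => exp (-s / ((L : ℝ) - 1)) ^ n L) atTop (nhds (exp (-s * μ))) := by
  have h1 := ((tendsto_div_natCast_sub_one h).const_mul (-s)).rexp
  refine h1.congr fun L => ?_
  rw [← Real.exp_nat_mul]
  congr 1
  ring

lemma tendsto_natCast_div_self : Tendsto (fun L : ℕ => (L : ℝ) / L) atTop (nhds 1) := by
  refine tendsto_const_nhds.congr' ?_
  filter_upwards [eventually_ge_atTop 1] with L hL
  have : (L : ℝ) ≠ 0 := by positivity
  field_simp

lemma tendsto_neg_div_natCast_sub_one (s : ℝ) :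
    Tendsto (fun L : ℕ => -s / ((L : ℝ) - 1)) atTop (nhds 0) :=
  tendsto_div_natCast_sub_one (f := fun _ => -s) (tendsto_const_div_atTop_nhds_zero_nat (-s))

lemma tendsto_natCast_mul_one_sub_exp {s : ℝ} (hs : s ≠ 0) :
    Tendsto (fun L : ℕ => (L : ℝ) * (1 - exp (-s / ((L : ℝ) - 1)))) atTop (nhds s) := by
  have h1 : Tendsto (fun t : ℝ => t⁻¹ * (exp t - 1)) (nhdsWithin 0 {0}ᶜ) (nhds 1) := by
    have := (Real.hasDerivAt_exp 0).tendsto_slope_zero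
    simpa using this
  have h2 : Tendsto (fun L : ℕ => -s / ((L : ℝ) - 1)) atTop (nhdsWithin 0 {0}ᶜ) := by
    refine tendsto_nhdsWithin_iff.2 ⟨tendsto_neg_div_natCast_sub_one s, ?_⟩
    filter_upwards [eventually_ge_atTop 2] with L hL
    have hL' : (2 : ℝ) ≤ L := by exact_mod_cast hL
    have h3 : (L : ℝ) - 1 ≠ 0 := by linarith
    simp [hs, h3]
  have h3 := ((h1.comp h2).mul (tendsto_div_natCast_sub_one tendsto_natCast_div_self)).mul_const s
  simp only [one_mul] at h3
  refine h3.congr' ?_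
  filter_upwards [eventually_ge_atTop 2] with L hL
  have hL' : (2 : ℝ) ≤ L := by exact_mod_cast hL
  have h3 : (L : ℝ) - 1 ≠ 0 := by linarith
  simp only [Function.comp]
  generalize exp (-s / ((L : ℝ) - 1)) = e
  field_simp
  ring

lemma tendsto_arithGeomSum {s : ℝ} (hs : s ≠ 0) {n : ℕ → ℕ} {μ : ℝ}
    (h : Tendsto (fun L : ℕ => (n L : ℝ) / L) atTop (nhds μ)) :
    Tendsto (fun L : ℕ => arithGeomSum (n L) (exp (-s / ((L : ℝ) - 1))) / (L : ℝ) ^ 2) atTop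
      (nhds ((1 - exp (-s * μ) - μ * exp (-s * μ) * s) / s ^ 2)) := by
  have h1 := tendsto_exp_neg_div_pow s h
  have h2 := tendsto_natCast_mul_one_sub_exp hs
  have h3 : Tendsto (fun L : ℕ => exp (-s / ((L : ℝ) - 1))) atTop (nhds 1) := by
    simpa using (tendsto_neg_div_natCast_sub_one s).rexp
  have h4 := ((h3.mul (h1.const_sub 1)).sub ((h.mul h1).mul h2)).div (h2.pow 2) (by positivity)
  rw [one_mul] at h4
  refine h4.congr' ?_
  filter_upwards [eventually_ge_atTop 2] with L hL
  have hL' : (2 : ℝ) ≤ L := by exact_mod_cast hL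
  have hL0 : (L : ℝ) ≠ 0 := by positivity
  have h5 : (L : ℝ) - 1 ≠ 0 := by linarith
  have h6 : 1 - exp (-s / ((L : ℝ) - 1)) ≠ 0 := by
    rw [sub_ne_zero, ne_comm, Ne, Real.exp_eq_one_iff]
    simp [hs, h5]
  have h7 := arithGeomSum_mul_sq (n L) (exp (-s / ((L : ℝ) - 1)))
  simp only [Pi.div_apply]
  generalize exp (-s / ((L : ℝ) - 1)) = e at *
  rw [div_eq_div_iff (by positivity) (by positivity), mul_pow]
  have h8 : (n L : ℝ) / L * e ^ n L * (L * (1 - e)) = n L * e ^ n L * (1 - e) := by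
    field_simp
  rw [h8, ← h7]
  ring

/-- The inner sum over the taps, in closed form. -/
lemma one_sub_sq_mul_overlap_sum (r : ℝ) {L P j : ℕ} (hj : 1 ≤ j) (hjL : j ≤ L) (hP : P ≤ L) :
    (1 - r ^ 2) * ∑ l ∈ Finset.Icc 1 (L - j), r ^ (j + 2 * (l - 1)) *
        ((if l ≤ P then (1 : ℝ) else 0) +
          (if (l : ℤ) ≤ (P : ℤ) - L + (L - j : ℕ) then (1 : ℝ) else 0)) ^ 2 =
      r ^ j * (1 - (r ^ 2) ^ min (L - j) P) + 3 * (r ^ j * (1 - (r ^ 2) ^ (P - j))) := by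
  have key : ∀ l ∈ Finset.Icc 1 (L - j), r ^ (j + 2 * (l - 1)) *
        ((if l ≤ P then (1 : ℝ) else 0) +
          (if (l : ℤ) ≤ (P : ℤ) - L + (L - j : ℕ) then (1 : ℝ) else 0)) ^ 2 =
      r ^ j * (if l ≤ P then (r ^ 2) ^ (l - 1) else 0) +
        3 * (r ^ j * (if l ≤ P - j then (r ^ 2) ^ (l - 1) else 0)) := by
    intro l hl
    rw [Finset.mem_Icc] at hl
    have hiff : ((l : ℤ) ≤ (P : ℤ) - L + (L - j : ℕ)) ↔ l ≤ P - j := by omega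
    simp only [hiff]
    rw [pow_add, pow_mul]
    by_cases h1 : l ≤ P - j
    · have h2 : l ≤ P := by omega
      simp only [h1, h2, if_true]
      ring
    · by_cases h2 : l ≤ P <;> simp [h1, h2]
  rw [Finset.sum_congr rfl key, Finset.sum_add_distrib, ← Finset.mul_sum, ← Finset.mul_sum,
    ← Finset.mul_sum, ← Finset.sum_filter, ← Finset.sum_filter]
  have e1 : (Finset.Icc 1 (L - j)).filter (fun l => l ≤ P) = Finset.Icc 1 (min (L - j) P) := by
    ext l; simp only [Finset.mem_filter, Finset.mem_Icc]; omega
  have e2 : (Finset.Icc 1 (L - j)).filter (fun l => l ≤ P - j) = Finset.Icc 1 (P - j) := by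
    ext l; simp only [Finset.mem_filter, Finset.mem_Icc]; omega
  rw [e1, e2, ← one_sub_sq_mul_sum_Icc, ← one_sub_sq_mul_sum_Icc]
  ring

lemma sum_mul_geom_min (r : ℝ) (hr : r ≠ 0) {L P : ℕ} (hP1 : 1 ≤ P) (hP : P ≤ L) :
    ∑ j ∈ Finset.range L, (j : ℝ) * (r ^ j * (1 - (r ^ 2) ^ min (L - j) P)) =
      arithGeomSum L r - (r ^ 2) ^ P * arithGeomSum (L - P + 1) r -
        (r ^ 2) ^ L * (arithGeomSum L r⁻¹ - arithGeomSum (L - P + 1) r⁻¹) := by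
  have hle : L - P + 1 ≤ L := by omega
  have h1 : ∑ j ∈ Finset.range (L - P + 1), (j : ℝ) * (r ^ j * (r ^ 2) ^ min (L - j) P) =
      (r ^ 2) ^ P * arithGeomSum (L - P + 1) r := by
    rw [arithGeomSum, Finset.mul_sum]
    refine Finset.sum_congr rfl fun j hj => ?_
    rw [Finset.mem_range] at hj
    rw [min_eq_right (by omega)]
    ring
  have h2 : ∑ j ∈ Finset.Ico (L - P + 1) L, (j : ℝ) * (r ^ j * (r ^ 2) ^ min (L - j) P) =
      (r ^ 2) ^ L * (arithGeomSum L r⁻¹ - arithGeomSum (L - P + 1) r⁻¹) := by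
    rw [arithGeomSum, arithGeomSum, ← Finset.sum_Ico_eq_sub _ hle, Finset.mul_sum]
    refine Finset.sum_congr rfl fun j hj => ?_
    rw [Finset.mem_Ico] at hj
    rw [min_eq_left (by omega)]
    obtain ⟨k, rfl⟩ := Nat.exists_eq_add_of_le hj.2.le
    rw [Nat.add_sub_cancel_left, pow_add, inv_pow]
    field_simp
    ring
  rw [← h1, ← h2, sub_sub, Finset.sum_range_add_sum_Ico _ hle, arithGeomSum,
    ← Finset.sum_sub_distrib]
  exact Finset.sum_congr rfl fun j _ => by ring

lemma sum_mul_geom_tsub (r : ℝ) (hr : r ≠ 0) {L P : ℕ} (hP : P ≤ L) :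
    ∑ j ∈ Finset.range L, (j : ℝ) * (r ^ j * (1 - (r ^ 2) ^ (P - j))) =
      arithGeomSum P r - (r ^ 2) ^ P * arithGeomSum P r⁻¹ := by
  rw [← Finset.sum_range_add_sum_Ico _ hP, Finset.sum_eq_zero (s := Finset.Ico P L), add_zero,
    arithGeomSum, arithGeomSum, Finset.mul_sum, ← Finset.sum_sub_distrib]
  · refine Finset.sum_congr rfl fun j hj => ?_
    rw [Finset.mem_range] at hj
    obtain ⟨k, rfl⟩ := Nat.exists_eq_add_of_le hj.le
    rw [Nat.add_sub_cancel_left, pow_add, inv_pow]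
    field_simp
    ring
  · intro j hj
    rw [Finset.mem_Ico] at hj
    simp [Nat.sub_eq_zero_of_le hj.1]

/-- The double sum in closed form, in terms of `r = ρ ^ (-1 / (L - 1))`. -/
lemma interference_sum_eq {ρ : ℝ} (hρ : 1 < ρ) {L P N : ℕ} (hL : 2 ≤ L) (hP1 : 1 ≤ P)
    (hP : P ≤ L) (hN : L ≤ N) {r : ℝ} (hr : r = exp (-Real.log ρ / ((L : ℝ) - 1))) :
    (∑ i ∈ Finset.Icc 1 (L - 1), ((min (L - i) N : ℕ) : ℝ) / (N : ℝ) *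
        ∑ l ∈ Finset.Icc 1 i, ρ ^ (-(((L : ℝ) + 2 * l - i - 2) / ((L : ℝ) - 1))) *
          ((if l ≤ P then (1 : ℝ) else 0) +
            (if (l : ℤ) ≤ (P : ℤ) - L + i then (1 : ℝ) else 0)) ^ 2) * (N * (1 - r ^ 2)) =
      arithGeomSum L r - (r ^ 2) ^ P * arithGeomSum (L - P + 1) r -
        (r ^ 2) ^ L * (arithGeomSum L r⁻¹ - arithGeomSum (L - P + 1) r⁻¹) +
        3 * (arithGeomSum P r - (r ^ 2) ^ P * arithGeomSum P r⁻¹) := by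
  have hr0 : r ≠ 0 := hr ▸ (exp_pos _).ne'
  have hN0 : (N : ℝ) ≠ 0 := by
    have : N ≠ 0 := by omega
    exact_mod_cast this
  rw [← sum_mul_geom_min r hr0 hP1 hP, ← sum_mul_geom_tsub r hr0 hP, Finset.mul_sum,
    ← Finset.sum_add_distrib, Finset.sum_mul]
  obtain ⟨M, rfl⟩ : ∃ M, L = M + 1 := ⟨L - 1, by omega⟩
  rw [Finset.sum_range_succ', Nat.cast_zero, zero_mul, zero_mul, mul_zero, add_zero, add_zero,
    Nat.add_sub_cancel]
  refine Finset.sum_bij' (fun i _ => M - i) (fun j _ => M - j) ?_ ?_ ?_ ?_ ?_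
  · intro i hi; rw [Finset.mem_Icc] at hi; rw [Finset.mem_range]; omega
  · intro j hj; rw [Finset.mem_range] at hj; rw [Finset.mem_Icc]; omega
  · intro i hi; rw [Finset.mem_Icc] at hi; omega
  · intro j hj; rw [Finset.mem_range] at hj; omega
  intro i hi
  rw [Finset.mem_Icc] at hi
  obtain ⟨k, rfl⟩ := Nat.exists_eq_add_of_le hi.2
  have e1 : i + k - i + 1 = k + 1 := by omega
  have e2 : min (i + k + 1 - i) N = k + 1 := by omega
  rw [e1, e2]
  have hin := one_sub_sq_mul_overlap_sum r (L := i + k + 1) (P := P) (j := k + 1)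
    (by omega) (by omega) hP
  have e3 : i + k + 1 - (k + 1) = i := by omega
  rw [e3] at hin ⊢
  have hsum : ∀ l ∈ Finset.Icc 1 i,
      ρ ^ (-((((i + k + 1 : ℕ) : ℝ) + 2 * l - i - 2) / (((i + k + 1 : ℕ) : ℝ) - 1))) *
          ((if l ≤ P then (1 : ℝ) else 0) +
            (if (l : ℤ) ≤ (P : ℤ) - (i + k + 1 : ℕ) + i then (1 : ℝ) else 0)) ^ 2 =
      r ^ (k + 1 + 2 * (l - 1)) *
          ((if l ≤ P then (1 : ℝ) else 0) +
            (if (l : ℤ) ≤ (P : ℤ) - (i + k + 1 : ℕ) + i then (1 : ℝ) else 0)) ^ 2 := by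
    intro l hl
    rw [Finset.mem_Icc] at hl
    obtain ⟨t, rfl⟩ := Nat.exists_eq_add_of_le hl.1
    congr 1
    rw [Real.rpow_def_of_pos (by linarith), hr, ← Real.exp_nat_mul, Nat.add_sub_cancel_left]
    congr 1
    push_cast
    ring
  rw [Finset.sum_congr rfl hsum]
  rw [← mul_assoc 3, mul_comm 3, mul_assoc _ (3 : ℝ), ← mul_add, ← hin]
  field_simp

/-- Normalized self-interference numerator limit for β ≥ 1 (eq. (41),
Appendix B): with N = ⌊βL⌋, P = ⌊α̂L⌋,
S_L = (1/L²)·Σ_{i=1}^{L−1} (min(L−i,N)/N) Σ_{l=1}^{i}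
ρ^{−(L+2l−i−2)/(L−1)}·(𝟙[l≤P] + 𝟙[l≤P−L+i])²
→ [2ρ(ρ^{2α̂}−1) − (ρ^α̂+α̂+3ρα̂−1)ρ^α̂ ln ρ]/(ρ^{2α̂+1} β (ln ρ)³). -/
theorem stmt_16 (ρ α β : ℝ) (hρ : 1 < ρ) (hα : α ∈ Set.Ioc (0:ℝ) 1) (hβ : 1 ≤ β) :
    Tendsto (fun L : ℕ =>
        (1 / (L : ℝ) ^ 2) *
          ∑ i ∈ Finset.Icc 1 (L - 1),
            ((min (L - i) ⌊β * (L : ℝ)⌋₊ : ℕ) : ℝ) / (⌊β * (L : ℝ)⌋₊ : ℝ) *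
              ∑ l ∈ Finset.Icc 1 i,
                ρ ^ (-(((L : ℝ) + 2 * l - i - 2) / ((L : ℝ) - 1))) *
                  ((if l ≤ ⌊α * (L : ℝ)⌋₊ then (1:ℝ) else 0) +
                    (if (l : ℤ) ≤ (⌊α * (L : ℝ)⌋₊ : ℤ) - L + i then (1:ℝ) else 0)) ^ 2)
      atTop
      (nhds ((2 * ρ * (ρ ^ (2 * α) - 1) -
          (ρ ^ α + α + 3 * ρ * α - 1) * ρ ^ α * Real.log ρ) /
        (ρ ^ (2 * α + 1) * β * Real.log ρ ^ 3))) := by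
  obtain ⟨hα0, hα1⟩ := hα
  have hc : 0 < Real.log ρ := Real.log_pos hρ
  have hρ0 : 0 < ρ := by linarith
  have hfl : ∀ a : ℝ, 0 < a →
      Tendsto (fun L : ℕ => ((⌊a * (L : ℝ)⌋₊ : ℕ) : ℝ) / L) atTop (nhds a) := fun a ha =>
    (tendsto_nat_floor_mul_div_atTop ha.le).comp tendsto_natCast_atTop_atTop
  have hPle : ∀ L : ℕ, ⌊α * (L : ℝ)⌋₊ ≤ L := fun L =>
    Nat.floor_le_of_le (mul_le_of_le_one_left (Nat.cast_nonneg L) hα1)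
  have hNge : ∀ L : ℕ, L ≤ ⌊β * (L : ℝ)⌋₊ := fun L =>
    Nat.le_floor (le_mul_of_one_le_left (Nat.cast_nonneg L) hβ)
  have hP := hfl α hα0
  have hN := hfl β (by linarith)
  have hQ : Tendsto (fun L : ℕ => ((L - ⌊α * (L : ℝ)⌋₊ + 1 : ℕ) : ℝ) / L) atTop
      (nhds (1 - α)) := by
    have h := (tendsto_natCast_div_self.sub hP).add tendsto_one_div_atTop_nhds_zero_nat
    rw [add_zero] at h
    refine h.congr fun L => ?_
    rw [Nat.cast_add, Nat.cast_sub (hPle L), Nat.cast_one]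
    ring
  have hP1 : ∀ᶠ L : ℕ in atTop, 1 ≤ ⌊α * (L : ℝ)⌋₊ := by
    filter_upwards [(tendsto_natCast_atTop_atTop.const_mul_atTop hα0).eventually_ge_atTop 1]
      with L hL
    exact Nat.le_floor (by simpa using hL)
  set c := Real.log ρ with hcdef
  let r : ℕ → ℝ := fun L => exp (-c / ((L : ℝ) - 1))
  have hrinv : ∀ L, (r L)⁻¹ = exp (-(-c) / ((L : ℝ) - 1)) := fun L => by
    rw [← Real.exp_neg]; congr 1; ring
  have hr2 : ∀ L, r L ^ 2 = exp (-(2 * c) / ((L : ℝ) - 1)) := fun L => by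
    rw [← Real.exp_nat_mul]; congr 1; push_cast; ring
  have hlim := ((((tendsto_arithGeomSum hc.ne' tendsto_natCast_div_self).sub
    ((tendsto_exp_neg_div_pow (2 * c) hP).mul (tendsto_arithGeomSum hc.ne' hQ))).sub
    ((tendsto_exp_neg_div_pow (2 * c) tendsto_natCast_div_self).mul
      ((tendsto_arithGeomSum (neg_ne_zero.2 hc.ne') tendsto_natCast_div_self).sub
        (tendsto_arithGeomSum (neg_ne_zero.2 hc.ne') hQ)))).add
    (((tendsto_arithGeomSum hc.ne' hP).sub ((tendsto_exp_neg_div_pow (2 * c) hP).mul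
      (tendsto_arithGeomSum (neg_ne_zero.2 hc.ne') hP))).const_mul 3)).div
    (hN.mul (tendsto_natCast_mul_one_sub_exp (s := 2 * c) (by positivity))) (by positivity)
  convert hlim.congr' ?_ using 2
  · have hE : ρ ^ α = exp (c * α) := Real.rpow_def_of_pos hρ0 _
    have hE2 : ρ ^ (2 * α) = exp (c * α) ^ 2 := by
      rw [Real.rpow_def_of_pos hρ0, ← Real.exp_nat_mul]; congr 1; push_cast; ring
    have hR : exp c = ρ := Real.exp_log hρ0
    have hE3 : ρ ^ (2 * α + 1) = exp (c * α) ^ 2 * ρ := by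
      rw [Real.rpow_add hρ0, hE2, Real.rpow_one]
    have g1 : exp (-c * 1) = ρ⁻¹ := by rw [mul_one, Real.exp_neg, hR]
    have g2 : exp (-(2 * c) * α) = (exp (c * α) ^ 2)⁻¹ := by
      rw [← Real.exp_nat_mul, ← Real.exp_neg]; congr 1; push_cast; ring
    have g3 : exp (-c * (1 - α)) = exp (c * α) * ρ⁻¹ := by
      rw [← hR, ← Real.exp_neg, ← Real.exp_add]; congr 1; ring
    have g4 : exp (-(2 * c) * 1) = (ρ ^ 2)⁻¹ := by
      rw [← hR, ← Real.exp_nat_mul, ← Real.exp_neg]; congr 1; push_cast; ring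
    have g5 : exp (-(-c) * 1) = ρ := by rw [mul_one, neg_neg, hR]
    have g6 : exp (-(-c) * (1 - α)) = ρ * (exp (c * α))⁻¹ := by
      rw [← hR, ← Real.exp_neg, ← Real.exp_add]; congr 1; ring
    have g7 : exp (-c * α) = (exp (c * α))⁻¹ := by
      rw [← Real.exp_neg]; congr 1; ring
    have g8 : exp (-(-c) * α) = exp (c * α) := by rw [neg_neg]
    rw [hE, hE2, hE3, g1, g2, g3, g4, g5, g6, g7, g8]
    have hEpos : exp (c * α) ≠ 0 := (Real.exp_pos _).ne'
    have hβ0 : β ≠ 0 := by positivity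
    have hc0 := hc.ne'
    generalize exp (c * α) = E at *
    clear_value c
    field_simp
    ring
  · filter_upwards [eventually_ge_atTop 2, hP1] with L hL hPL
    have hL' : (2 : ℝ) ≤ L := by exact_mod_cast hL
    have hL0 : (L : ℝ) ≠ 0 := by positivity
    have h5 : (L : ℝ) - 1 ≠ 0 := by linarith
    have h6 : 1 - r L ^ 2 ≠ 0 := by
      rw [hr2, sub_ne_zero, ne_comm, Ne, Real.exp_eq_one_iff]
      simp [hc.ne', h5]
    have hN0 : (⌊β * (L : ℝ)⌋₊ : ℝ) ≠ 0 := by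
      have := hNge L
      have : ⌊β * (L : ℝ)⌋₊ ≠ 0 := by omega
      exact_mod_cast this
    have key := interference_sum_eq hρ hL hPL (hPle L) (hNge L) (r := r L) rfl
    rw [← eq_div_iff (mul_ne_zero hN0 h6)] at key
    rw [key]
    simp only [Pi.div_apply, ← hr2, ← hrinv]
    rw [show exp (-c / ((L : ℝ) - 1)) = r L from rfl]
    field_simp
end

section
/- Fix ρ > 1. Then the function β ↦ ν_A(ρ,β) := 2·(ρ² − 1 + ρ^β − ρ^{2−β} − 2ρβ·ln ρ) / ((ρ − 1)²·β·ln ρ) is strictly decreasing on (0,1]. -/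
open Real

/-- The map `β ↦ ρ ^ β - ρ ^ (2 - β)` is strictly concave on `[0, 1]` for `1 < ρ`. -/
theorem strictConcaveOn_rpow_sub_rpow_two_sub {ρ : ℝ} (hρ : 1 < ρ) :
    StrictConcaveOn ℝ (Set.Icc 0 1) (fun β : ℝ => ρ ^ β - ρ ^ (2 - β)) := by
  have h0 : 0 < ρ := by linarith
  have hL : 0 < Real.log ρ := Real.log_pos hρ
  have d1 (x : ℝ) : HasDerivAt (fun β : ℝ => ρ ^ β) (Real.log ρ * ρ ^ x) x := by
    simpa using (hasDerivAt_id x).const_rpow h0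
  have d2 (x : ℝ) : HasDerivAt (fun β : ℝ => ρ ^ (2 - β)) (-(Real.log ρ * ρ ^ (2 - x))) x := by
    simpa using ((hasDerivAt_id x).const_sub 2).const_rpow h0
  have hderiv : deriv (fun β : ℝ => ρ ^ β - ρ ^ (2 - β)) =
      fun β => Real.log ρ * ρ ^ β + Real.log ρ * ρ ^ (2 - β) := by
    ext x
    rw [((d1 x).fun_sub (d2 x)).deriv]
    ring
  refine strictConcaveOn_of_deriv2_neg (convex_Icc 0 1)
    (fun x _ => ((d1 x).fun_sub (d2 x)).continuousAt.continuousWithinAt) fun x hx => ?_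
  rw [interior_Icc] at hx
  have hlt : ρ ^ x < ρ ^ (2 - x) := Real.rpow_lt_rpow_of_exponent_lt hρ (by linarith [hx.2])
  have hderiv2 : deriv^[2] (fun β : ℝ => ρ ^ β - ρ ^ (2 - β)) x =
      Real.log ρ ^ 2 * (ρ ^ x - ρ ^ (2 - x)) := by
    rw [Function.iterate_succ_apply, Function.iterate_one, hderiv,
      (((d1 x).const_mul _).fun_add ((d2 x).const_mul _)).deriv]
    ring
  rw [hderiv2]
  exact mul_neg_of_pos_of_neg (by positivity) (by linarith)

/-- For fixed ρ > 1, the ARake self-interference factor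
β ↦ ν_A(ρ,β) = 2(ρ² − 1 + ρ^β − ρ^{2−β} − 2ρβ ln ρ)/((ρ−1)²β ln ρ)
is strictly decreasing on (0,1] (Section III-E). -/
theorem stmt_19 (ρ : ℝ) (hρ : 1 < ρ) :
    StrictAntiOn (fun β : ℝ =>
        2 * (ρ ^ 2 - 1 + ρ ^ β - ρ ^ (2 - β) - 2 * ρ * β * Real.log ρ) /
          ((ρ - 1) ^ 2 * β * Real.log ρ))
      (Set.Ioc 0 1) := by
  rintro x ⟨hx0, hx1⟩ y ⟨hy0, hy1⟩ hxy
  have hL : 0 < Real.log ρ := Real.log_pos hρ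
  have hρ1 : 0 < ρ - 1 := by linarith
  have hslope := (strictConcaveOn_rpow_sub_rpow_two_sub hρ).slope_anti_adjacent
    (Set.left_mem_Icc.mpr zero_le_one) ⟨hy0.le, hy1⟩ hx0 hxy
  rw [div_lt_div_iff₀ (by linarith) (by linarith)] at hslope
  simp only [Real.rpow_zero, sub_zero, Real.rpow_two] at hslope
  have hkey : x * (ρ ^ 2 - 1 + ρ ^ y - ρ ^ (2 - y)) < y * (ρ ^ 2 - 1 + ρ ^ x - ρ ^ (2 - x)) := by
    linarith
  have hpos : 0 < 2 * ((ρ - 1) ^ 2 * Real.log ρ) := by positivity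
  beta_reduce
  rw [div_lt_div_iff₀ (by positivity) (by positivity)]
  linarith [mul_lt_mul_of_pos_left hkey hpos]
end
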